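/- arXiv:1004.4060 — 10 statements merged into one kernel-verified Lean document; each statement's English description precedes it below -/
import Mathlib

section
/- Let V be a real inner product space of dimension 2m with m ≥ 2, J an orthogonal complex structure on V, R an algebraic curvature tensor on V, and fix θ ∈ (0, π/2). If hypothesis (1) holds for every admissible pair, then R(Jx, x, x, Jy) = 0 for every admissible pair (x, y). -/
open scoped RealInnerProductSpace
open Real

theorem stmt0
    (V : Type*) [NormedAddCommGroup V] [InnerProductSpace ℝ V] [FiniteDimensional ℝ V]
    (m : ℕ) (hm : 2 ≤ m) (hdim : Module.finrank ℝ V = 2 * m)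
    (J : V →ₗᵢ[ℝ] V) (hJ : ∀ x : V, J (J x) = -x)
    (R : V →ₗ[ℝ] V →ₗ[ℝ] V →ₗ[ℝ] V →ₗ[ℝ] ℝ)
    (hsym1 : ∀ x y z u : V, R x y z u = - R y x z u)
    (hsym2 : ∀ x y z u : V, R x y z u = - R x y u z)
    (hsym3 : ∀ x y z u : V, R x y z u = R z u x y)
    (hbianchi : ∀ x y z u : V, R x y z u + R y z x u + R z x y u = 0)
    (θ : ℝ) (hθ : θ ∈ Set.Ioo 0 (π / 2))
    (h1 : ∀ x y : V, ‖x‖ = 1 → ‖y‖ = 1 → ⟪x, y⟫ = 0 → ⟪x, J y⟫ = 0 →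
      R (Real.cos θ • J x + Real.sin θ • y) x x (J y) = 0)
 :
    ∀ x y : V, ‖x‖ = 1 → ‖y‖ = 1 → ⟪x, y⟫ = 0 → ⟪x, J y⟫ = 0 →
      R (J x) x x (J y) = 0 := by
  intro x y hx hy hxy hxJ
  have hc : 0 < Real.cos θ :=
    Real.cos_pos_of_mem_Ioo ⟨by linarith [hθ.1, Real.pi_pos], hθ.2⟩
  have a := h1 x y hx hy hxy hxJ
  have b := h1 x (-y) hx (by simpa using hy) (by simpa using hxy) (by simpa using hxJ)
  simp only [map_add, map_smul, map_neg, smul_neg, LinearMap.add_apply, LinearMap.smul_apply,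
    smul_eq_mul] at a b
  have e : R (-(Real.sin θ • y)) x x (J y) = -(Real.sin θ * R y x x (J y)) := by
    rw [← neg_smul]
    simp only [map_smul, LinearMap.smul_apply, smul_eq_mul, neg_mul]
  rw [e] at b
  have h : Real.cos θ * R (J x) x x (J y) = 0 := by linarith
  exact (mul_eq_zero.mp h).resolve_left hc.ne'
end

section
/- Let V be a real inner product space of dimension 2m with m ≥ 2, J an orthogonal complex structure on V, R an algebraic curvature tensor on V, and fix θ ∈ (0, π/2). If hypothesis (1) holds for every admissible pair, then R(y, x, x, Jy) = 0 for every admissible pair (x, y). -/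
open scoped RealInnerProductSpace
open Real

theorem stmt1
    (V : Type*) [NormedAddCommGroup V] [InnerProductSpace ℝ V] [FiniteDimensional ℝ V]
    (m : ℕ) (hm : 2 ≤ m) (hdim : Module.finrank ℝ V = 2 * m)
    (J : V →ₗᵢ[ℝ] V) (hJ : ∀ x : V, J (J x) = -x)
    (R : V →ₗ[ℝ] V →ₗ[ℝ] V →ₗ[ℝ] V →ₗ[ℝ] ℝ)
    (hsym1 : ∀ x y z u : V, R x y z u = - R y x z u)
    (hsym2 : ∀ x y z u : V, R x y z u = - R x y u z)
    (hsym3 : ∀ x y z u : V, R x y z u = R z u x y)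
    (hbianchi : ∀ x y z u : V, R x y z u + R y z x u + R z x y u = 0)
    (θ : ℝ) (hθ : θ ∈ Set.Ioo 0 (π / 2))
    (h1 : ∀ x y : V, ‖x‖ = 1 → ‖y‖ = 1 → ⟪x, y⟫ = 0 → ⟪x, J y⟫ = 0 →
      R (Real.cos θ • J x + Real.sin θ • y) x x (J y) = 0)
 :
    ∀ x y : V, ‖x‖ = 1 → ‖y‖ = 1 → ⟪x, y⟫ = 0 → ⟪x, J y⟫ = 0 →
      R y x x (J y) = 0 := by
  intro x y hx hy hxy hxJy
  have hs : 0 < Real.sin θ :=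
    Real.sin_pos_of_pos_of_lt_pi hθ.1 (by linarith [hθ.2, Real.pi_pos])
  have a := h1 x y hx hy hxy hxJy
  have b := h1 x (-y) hx (by simpa using hy) (by simpa using hxy) (by simpa using hxJy)
  simp only [map_add, map_smul, map_neg, LinearMap.add_apply, LinearMap.smul_apply,
    smul_eq_mul, smul_neg, ← neg_smul] at a b
  have c : Real.sin θ * R y x x (J y) = 0 := by linarith
  exact (mul_eq_zero.mp c).resolve_left hs.ne'
end

section
/- Let V be a real inner product space of dimension 2m with m ≥ 2, J an orthogonal complex structure on V, R an algebraic curvature tensor on V, and fix θ ∈ (0, π/2). If hypotheses (1) and (2) hold for every admissible pair, then H(x) = K(x, y) for every admissible pair (x, y), where H(x) = R(x, Jx, Jx, x) and K(x, y) = R(x, y, y, x). -/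
open scoped RealInnerProductSpace
open Real

theorem stmt2
    (V : Type*) [NormedAddCommGroup V] [InnerProductSpace ℝ V] [FiniteDimensional ℝ V]
    (m : ℕ) (hm : 2 ≤ m) (hdim : Module.finrank ℝ V = 2 * m)
    (J : V →ₗᵢ[ℝ] V) (hJ : ∀ x : V, J (J x) = -x)
    (R : V →ₗ[ℝ] V →ₗ[ℝ] V →ₗ[ℝ] V →ₗ[ℝ] ℝ)
    (hsym1 : ∀ x y z u : V, R x y z u = - R y x z u)
    (hsym2 : ∀ x y z u : V, R x y z u = - R x y u z)
    (hsym3 : ∀ x y z u : V, R x y z u = R z u x y)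
    (hbianchi : ∀ x y z u : V, R x y z u + R y z x u + R z x y u = 0)
    (θ : ℝ) (hθ : θ ∈ Set.Ioo 0 (π / 2))
    (h1 : ∀ x y : V, ‖x‖ = 1 → ‖y‖ = 1 → ⟪x, y⟫ = 0 → ⟪x, J y⟫ = 0 →
      R (Real.cos θ • J x + Real.sin θ • y) x x (J y) = 0)
    (h2 : ∀ x y : V, ‖x‖ = 1 → ‖y‖ = 1 → ⟪x, y⟫ = 0 → ⟪x, J y⟫ = 0 →
      R (Real.cos θ • J x + Real.sin θ • y) x x (Real.sin θ • J x - Real.cos θ • y) = 0)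
 :
    ∀ x y : V, ‖x‖ = 1 → ‖y‖ = 1 → ⟪x, y⟫ = 0 → ⟪x, J y⟫ = 0 →
      R x (J x) (J x) x = R x y y x := by
  intro x y hx hy hxy hxJ
  have hs : 0 < Real.sin θ := Real.sin_pos_of_pos_of_lt_pi hθ.1 (by linarith [hθ.2, Real.pi_pos])
  have hc : 0 < Real.cos θ := Real.cos_pos_of_mem_Ioo ⟨by linarith [hθ.1, Real.pi_pos], hθ.2⟩
  have a := h2 x y hx hy hxy hxJ
  have b := h2 x (-y) hx (by simpa using hy) (by simpa using hxy) (by simpa using hxJ)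
  simp only [map_add, map_sub, map_neg, map_smul, LinearMap.add_apply,
    LinearMap.smul_apply, smul_eq_mul] at a b
  have n : ∀ u : V, R (-y) x x u = - R y x x u := by
    intro u
    rw [hsym1, hsym3, hsym1 y, hsym3 x y, map_neg]
  rw [n, n] at b
  have e1 : R x (J x) (J x) x = R (J x) x x (J x) := hsym3 _ _ _ _
  have e2 : R x y y x = R y x x y := hsym3 _ _ _ _
  rw [e1, e2]
  have h : (Real.cos θ * Real.sin θ) * (R (J x) x x (J x)) =
      (Real.cos θ * Real.sin θ) * (R y x x y) := by linarith
  exact mul_left_cancel₀ (mul_pos hc hs).ne' h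
end

section
/- Let V be a real inner product space of dimension 2m with m ≥ 2, J an orthogonal complex structure on V, R an algebraic curvature tensor on V, and fix θ ∈ (0, π/2). If hypotheses (1) and (2) hold for every admissible pair, then H(x) = H(y) for every admissible pair (x, y), where H(x) = R(x, Jx, Jx, x). -/
open scoped RealInnerProductSpace
open Real

theorem stmt3
    (V : Type*) [NormedAddCommGroup V] [InnerProductSpace ℝ V] [FiniteDimensional ℝ V]
    (m : ℕ) (hm : 2 ≤ m) (hdim : Module.finrank ℝ V = 2 * m)
    (J : V →ₗᵢ[ℝ] V) (hJ : ∀ x : V, J (J x) = -x)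
    (R : V →ₗ[ℝ] V →ₗ[ℝ] V →ₗ[ℝ] V →ₗ[ℝ] ℝ)
    (hsym1 : ∀ x y z u : V, R x y z u = - R y x z u)
    (hsym2 : ∀ x y z u : V, R x y z u = - R x y u z)
    (hsym3 : ∀ x y z u : V, R x y z u = R z u x y)
    (hbianchi : ∀ x y z u : V, R x y z u + R y z x u + R z x y u = 0)
    (θ : ℝ) (hθ : θ ∈ Set.Ioo 0 (π / 2))
    (h1 : ∀ x y : V, ‖x‖ = 1 → ‖y‖ = 1 → ⟪x, y⟫ = 0 → ⟪x, J y⟫ = 0 →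
      R (Real.cos θ • J x + Real.sin θ • y) x x (J y) = 0)
    (h2 : ∀ x y : V, ‖x‖ = 1 → ‖y‖ = 1 → ⟪x, y⟫ = 0 → ⟪x, J y⟫ = 0 →
      R (Real.cos θ • J x + Real.sin θ • y) x x (Real.sin θ • J x - Real.cos θ • y) = 0)
 :
    ∀ x y : V, ‖x‖ = 1 → ‖y‖ = 1 → ⟪x, y⟫ = 0 → ⟪x, J y⟫ = 0 →
      R x (J x) (J x) x = R y (J y) (J y) y := by
  have hs : 0 < Real.sin θ := Real.sin_pos_of_pos_of_lt_pi hθ.1 (by linarith [hθ.2, Real.pi_pos])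
  have hc : 0 < Real.cos θ := Real.cos_pos_of_mem_Ioo ⟨by linarith [hθ.1, Real.pi_pos], hθ.2⟩
  -- adding hypothesis (2) for `y` and `-y` gives `H(x) = K(x, y)`
  have key : ∀ x y : V, ‖x‖ = 1 → ‖y‖ = 1 → ⟪x, y⟫ = 0 → ⟪x, J y⟫ = 0 →
      R (J x) x x (J x) = R y x x y := by
    intro x y hx hy h h'
    have e1 := h2 x y hx hy h h'
    have e2 := h2 x (-y) hx (by simpa using hy) (by simpa using h) (by simpa using h')
    simp only [map_add, map_sub, map_smul, LinearMap.add_apply,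
      LinearMap.smul_apply, smul_eq_mul, smul_neg, ← neg_smul] at e1 e2
    have e3 : (Real.cos θ * Real.sin θ) * (R (J x) x x (J x) - R y x x y) = 0 := by
      linear_combination (e1 + e2) / 2
    have := (mul_eq_zero.mp e3).resolve_left (mul_pos hc hs).ne'
    linarith
  intro x y hx hy h h'
  have h3 : ⟪y, x⟫ = 0 := by rw [real_inner_comm]; exact h
  have h4 : ⟪y, J x⟫ = 0 := by
    have := J.inner_map_map y (J x)
    rw [hJ, inner_neg_right, real_inner_comm, h'] at this
    linarith
  have a := key x y hx hy h h'
  have b := key y x hy hx h3 h4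
  rw [hsym3 x, hsym3 y (J y), a, b, hsym3]
end

section
/- Let V be a real inner product space of dimension 2m with m > 2, J an orthogonal complex structure on V, R an algebraic curvature tensor on V, and fix θ ∈ (0, π/2). If hypotheses (1) and (2) hold for every admissible pair, then H(u) = H(v) for all unit vectors u, v ∈ V, where H(x) = R(x, Jx, Jx, x); that is, R has constant holomorphic sectional curvature. -/
open scoped RealInnerProductSpace
open Real

theorem stmt4
    (V : Type*) [NormedAddCommGroup V] [InnerProductSpace ℝ V] [FiniteDimensional ℝ V]
    (m : ℕ) (hm : 2 < m) (hdim : Module.finrank ℝ V = 2 * m)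
    (J : V →ₗᵢ[ℝ] V) (hJ : ∀ x : V, J (J x) = -x)
    (R : V →ₗ[ℝ] V →ₗ[ℝ] V →ₗ[ℝ] V →ₗ[ℝ] ℝ)
    (hsym1 : ∀ x y z u : V, R x y z u = - R y x z u)
    (hsym2 : ∀ x y z u : V, R x y z u = - R x y u z)
    (hsym3 : ∀ x y z u : V, R x y z u = R z u x y)
    (hbianchi : ∀ x y z u : V, R x y z u + R y z x u + R z x y u = 0)
    (θ : ℝ) (hθ : θ ∈ Set.Ioo 0 (π / 2))
    (h1 : ∀ x y : V, ‖x‖ = 1 → ‖y‖ = 1 → ⟪x, y⟫ = 0 → ⟪x, J y⟫ = 0 →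
      R (Real.cos θ • J x + Real.sin θ • y) x x (J y) = 0)
    (h2 : ∀ x y : V, ‖x‖ = 1 → ‖y‖ = 1 → ⟪x, y⟫ = 0 → ⟪x, J y⟫ = 0 →
      R (Real.cos θ • J x + Real.sin θ • y) x x (Real.sin θ • J x - Real.cos θ • y) = 0)
 :
    ∀ u v : V, ‖u‖ = 1 → ‖v‖ = 1 →
      R u (J u) (J u) u = R v (J v) (J v) v := by
  classical
  have hs : Real.sin θ ≠ 0 := (Real.sin_pos_of_pos_of_lt_pi hθ.1 (by linarith [hθ.2, Real.pi_pos])).ne'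
  have hc : Real.cos θ ≠ 0 := (Real.cos_pos_of_mem_Ioo ⟨by linarith [hθ.1, Real.pi_pos], hθ.2⟩).ne'
  have key : ∀ x y : V, ‖x‖ = 1 → ‖y‖ = 1 → ⟪x, y⟫ = 0 → ⟪x, J y⟫ = 0 →
      R (J x) x x (J x) = R y x x y := by
    intro x y hx hy hxy hxJ
    have a := h2 x y hx hy hxy hxJ
    have b := h2 x (-y) hx (by simpa using hy) (by simpa using hxy) (by simpa using hxJ)
    simp only [map_add, map_sub, map_smul, smul_neg, ← neg_smul, sub_neg_eq_add, smul_eq_mul,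
      LinearMap.add_apply, LinearMap.smul_apply] at a b
    have e : (Real.sin θ * Real.cos θ) * (R (J x) x x (J x) - R y x x y) = 0 := by
      linear_combination (a + b) / 2
    rcases mul_eq_zero.mp e with h | h
    · exact absurd h (mul_ne_zero hs hc)
    · linarith
  have hJi : ∀ a b : V, ⟪a, J b⟫ = - ⟪J a, b⟫ := by
    intro a b
    rw [← J.inner_map_map a (J b), hJ, inner_neg_right]
  have H : ∀ x y : V, ‖x‖ = 1 → ‖y‖ = 1 → ⟪x, y⟫ = 0 → ⟪J x, y⟫ = 0 →
      R x (J x) (J x) x = R y (J y) (J y) y := by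
    intro x y hx hy hxy hxJ
    have a := key x y hx hy hxy (by rw [hJi, hxJ, neg_zero])
    have b := key y x hy hx (by rw [real_inner_comm, hxy]) (by rw [real_inner_comm, hxJ])
    rw [hsym3 x (J x) (J x) x, hsym3 y (J y) (J y) y, a, b, hsym1 y x x y, hsym2 x y x y, neg_neg]
  intro u v hu hv
  obtain ⟨w, hw, hwo⟩ : ∃ w : V, ‖w‖ = 1 ∧
      ∀ z ∈ ({u, J u, v, J v} : Finset V), ⟪z, w⟫ = 0 := by
    let S : Submodule ℝ V := Submodule.span ℝ (({u, J u, v, J v} : Finset V) : Set V)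
    have hS : Module.finrank ℝ S ≤ 4 := (finrank_span_finset_le_card _).trans Finset.card_le_four
    have hne : Sᗮ ≠ ⊥ := by
      intro h
      have := S.finrank_add_finrank_orthogonal
      rw [h, finrank_bot] at this
      omega
    obtain ⟨w, hwS, hw0⟩ := Submodule.exists_mem_ne_zero_of_ne_bot hne
    refine ⟨‖w‖⁻¹ • w, ?_, ?_⟩
    · rw [norm_smul, norm_inv, norm_norm, inv_mul_cancel₀ (norm_ne_zero_iff.mpr hw0)]
    · intro z hz
      rw [inner_smul_right, (Submodule.mem_orthogonal S w).mp hwS z (Submodule.subset_span hz),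
        mul_zero]
  rw [H u w hu hw (hwo _ (by simp)) (hwo _ (by simp)),
    H v w hv hw (hwo _ (by simp)) (hwo _ (by simp))]
end

section
/- Let V be a real inner product space of dimension 2m with m > 2, J an orthogonal complex structure on V, R an algebraic curvature tensor on V, and fix θ ∈ (0, π/2). If hypotheses (1) and (2) hold for every admissible pair, then there exists a real constant c such that K(x, y) = R(x, y, y, x) = c for every admissible pair (x, y), and moreover c = H(u) = R(u, Ju, Ju, u) for every unit vector u; that is, R has constant antiholomorphic sectional curvature equal to its constant holomorphic sectional curvature. -/
open scoped RealInnerProductSpace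
open Real

theorem stmt5
    (V : Type*) [NormedAddCommGroup V] [InnerProductSpace ℝ V] [FiniteDimensional ℝ V]
    (m : ℕ) (hm : 2 < m) (hdim : Module.finrank ℝ V = 2 * m)
    (J : V →ₗᵢ[ℝ] V) (hJ : ∀ x : V, J (J x) = -x)
    (R : V →ₗ[ℝ] V →ₗ[ℝ] V →ₗ[ℝ] V →ₗ[ℝ] ℝ)
    (hsym1 : ∀ x y z u : V, R x y z u = - R y x z u)
    (hsym2 : ∀ x y z u : V, R x y z u = - R x y u z)
    (hsym3 : ∀ x y z u : V, R x y z u = R z u x y)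
    (hbianchi : ∀ x y z u : V, R x y z u + R y z x u + R z x y u = 0)
    (θ : ℝ) (hθ : θ ∈ Set.Ioo 0 (π / 2))
    (h1 : ∀ x y : V, ‖x‖ = 1 → ‖y‖ = 1 → ⟪x, y⟫ = 0 → ⟪x, J y⟫ = 0 →
      R (Real.cos θ • J x + Real.sin θ • y) x x (J y) = 0)
    (h2 : ∀ x y : V, ‖x‖ = 1 → ‖y‖ = 1 → ⟪x, y⟫ = 0 → ⟪x, J y⟫ = 0 →
      R (Real.cos θ • J x + Real.sin θ • y) x x (Real.sin θ • J x - Real.cos θ • y) = 0)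
 :
    ∃ c : ℝ,
      (∀ x y : V, ‖x‖ = 1 → ‖y‖ = 1 → ⟪x, y⟫ = 0 → ⟪x, J y⟫ = 0 →
        R x y y x = c) ∧
      (∀ u : V, ‖u‖ = 1 → R u (J u) (J u) u = c) := by
  have hs : 0 < Real.sin θ := Real.sin_pos_of_pos_of_lt_pi hθ.1 (by linarith [hθ.2, Real.pi_pos])
  have hc : 0 < Real.cos θ := Real.cos_pos_of_mem_Ioo ⟨by linarith [hθ.1, Real.pi_pos], hθ.2⟩
  -- the two hypotheses for `y` and `-y` give `H x = K x y`
  have hHK : ∀ x y : V, ‖x‖ = 1 → ‖y‖ = 1 → ⟪x, y⟫ = 0 → ⟪x, J y⟫ = 0 →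
      R x y y x = R x (J x) (J x) x := by
    intro x y hx hy hxy hxJy
    have hRn : ∀ v a b d : V, R (-v) a b d = -R v a b d := by
      intro v a b d
      rw [hsym1, map_neg, LinearMap.neg_apply, LinearMap.neg_apply, hsym1 v a b d]
    have e1 := h2 x y hx hy hxy hxJy
    have e2 := h2 x (-y) hx (by rwa [norm_neg]) (by rw [inner_neg_right, hxy, neg_zero])
      (by rw [map_neg, inner_neg_right, hxJy, neg_zero])
    simp only [map_add, map_sub, map_smul, map_neg, hRn, LinearMap.add_apply, LinearMap.smul_apply,
      LinearMap.neg_apply, smul_eq_mul, smul_neg] at e1 e2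
    have e3 : (Real.cos θ * Real.sin θ) * (R (J x) x x (J x) - R y x x y) = 0 := by
      linarith
    have e4 := (mul_eq_zero.mp e3).resolve_left (by positivity)
    rw [hsym3 x y y x, hsym3 x (J x) (J x) x]
    linarith
  have hflip : ∀ x y : V, ⟪x, J y⟫ = -⟪J x, y⟫ := by
    intro x y
    rw [← J.inner_map_map x (J y), hJ, inner_neg_right]
  have hHH : ∀ x y : V, ‖x‖ = 1 → ‖y‖ = 1 → ⟪x, y⟫ = 0 → ⟪x, J y⟫ = 0 →
      R x (J x) (J x) x = R y (J y) (J y) y := by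
    intro x y hx hy hxy hxJy
    rw [← hHK x y hx hy hxy hxJy, hsym3 x y y x]
    refine hHK y x hy hx (by rw [real_inner_comm, hxy]) ?_
    rw [hflip, real_inner_comm, hxJy, neg_zero]
  have hH : ∀ x y : V, ‖x‖ = 1 → ‖y‖ = 1 → R x (J x) (J x) x = R y (J y) (J y) y := by
    intro x y hx hy
    classical
    let S : Finset V := {x, J x, y, J y}
    let W : Submodule ℝ V := Submodule.span ℝ (S : Set V)
    have hW : Module.finrank ℝ W ≤ 4 :=
      (finrank_span_finset_le_card S).trans Finset.card_le_four
    have hadd := W.finrank_add_finrank_orthogonal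
    have hne : Wᗮ ≠ ⊥ := by
      intro h
      rw [h, finrank_bot] at hadd
      omega
    obtain ⟨w, hw, hw0⟩ := Submodule.exists_mem_ne_zero_of_ne_bot hne
    have hn : ‖(‖w‖⁻¹ : ℝ) • w‖ = 1 := by
      rw [norm_smul, norm_inv, norm_norm, inv_mul_cancel₀ (norm_ne_zero_iff.mpr hw0)]
    have hz := Wᗮ.smul_mem (‖w‖⁻¹ : ℝ) hw
    generalize (‖w‖⁻¹ : ℝ) • w = z at hn hz
    have hort : ∀ v ∈ S, ⟪v, z⟫ = 0 := fun v hv =>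
      (Submodule.mem_orthogonal W z).mp hz v (Submodule.subset_span hv)
    rw [hHH x z hx hn (hort x (by simp [S])) (by rw [hflip, hort _ (by simp [S]), neg_zero]),
      hHH y z hy hn (hort y (by simp [S])) (by rw [hflip, hort _ (by simp [S]), neg_zero])]
  have : Nontrivial V := Module.nontrivial_of_finrank_pos (R := ℝ) (by omega)
  obtain ⟨e, he⟩ := exists_norm_eq V (zero_le_one' ℝ)
  exact ⟨R e (J e) (J e) e, fun x y hx hy hxy hxJy =>
    (hHK x y hx hy hxy hxJy).trans (hH x e hx he), fun u hu => hH u e hu he⟩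
end

section
/- Let V be a real inner product space of dimension 2m with m ≥ 2 and J an orthogonal complex structure on V. Every 2-dimensional subspace β of V with ∠(β, Jβ) = φ admits an orthonormal basis of the form {x, Jx cos φ + y sin φ}, where x and y are unit vectors of V with ⟨x, y⟩ = 0 and ⟨x, Jy⟩ = 0. -/
open scoped RealInnerProductSpace
open Real

theorem exists_unit_orth {V : Type*} [NormedAddCommGroup V] [InnerProductSpace ℝ V]
    [FiniteDimensional ℝ V] (h : 4 ≤ Module.finrank ℝ V) (a b : V) :
    ∃ y : V, ‖y‖ = 1 ∧ ⟪a, y⟫ = 0 ∧ ⟪b, y⟫ = 0 := by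
  classical
  set K : Submodule ℝ V := Submodule.span ℝ (({a, b} : Finset V) : Set V) with hK
  have h1 : Module.finrank ℝ K ≤ 2 :=
    (finrank_span_finset_le_card ({a, b} : Finset V)).trans Finset.card_le_two
  have h2 := K.finrank_add_finrank_orthogonal
  have h3 : Kᗮ ≠ ⊥ := by
    intro h0
    rw [h0, finrank_bot] at h2
    omega
  obtain ⟨z, hz, hz0⟩ := Submodule.exists_mem_ne_zero_of_ne_bot h3
  have ha : ⟪a, z⟫ = 0 := hz a (Submodule.subset_span (by simp))
  have hb : ⟪b, z⟫ = 0 := hz b (Submodule.subset_span (by simp))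
  refine ⟨‖z‖⁻¹ • z, ?_, ?_, ?_⟩
  · rw [norm_smul, norm_inv, norm_norm, inv_mul_cancel₀ (norm_ne_zero_iff.2 hz0)]
  · rw [inner_smul_right, ha, mul_zero]
  · rw [inner_smul_right, hb, mul_zero]

theorem exists_y {V : Type*} [NormedAddCommGroup V] [InnerProductSpace ℝ V]
    [FiniteDimensional ℝ V] (h : 4 ≤ Module.finrank ℝ V) (x j w : V) (c s : ℝ)
    (hs : c ^ 2 + s ^ 2 = 1) (hs0 : 0 ≤ s) (hc : 0 ≤ c) (hj : ‖j‖ = 1) (hw : ‖w‖ = 1)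
    (hxj : ⟪x, j⟫ = 0) (hxw : ⟪x, w⟫ = 0) (hjw : ⟪j, w⟫ = c) :
    ∃ y : V, ‖y‖ = 1 ∧ ⟪x, y⟫ = 0 ∧ ⟪j, y⟫ = 0 ∧ c • j + s • y = w := by
  have hjj : ⟪j, j⟫ = 1 := by rw [real_inner_self_eq_norm_sq, hj]; norm_num
  have hn : ‖w - c • j‖ ^ 2 = s ^ 2 := by
    rw [norm_sub_sq_real, inner_smul_right, real_inner_comm, hjw, norm_smul, hj, hw,
      Real.norm_eq_abs, mul_one, sq_abs]
    linarith
  have hn' : ‖w - c • j‖ = s := (sq_eq_sq₀ (norm_nonneg _) hs0).1 hn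
  rcases eq_or_ne s 0 with h0 | h0
  · obtain ⟨y, h1, h2, h3⟩ := exists_unit_orth h x j
    refine ⟨y, h1, h2, h3, ?_⟩
    rw [h0, norm_eq_zero, sub_eq_zero] at hn'
    rw [h0, zero_smul, add_zero, hn']
  · refine ⟨s⁻¹ • (w - c • j), ?_, ?_, ?_, ?_⟩
    · rw [norm_smul, hn', norm_inv, Real.norm_of_nonneg hs0, inv_mul_cancel₀ h0]
    · simp [inner_smul_right, inner_sub_right, hxw, hxj]
    · simp [inner_smul_right, inner_sub_right, hjw, hjj, hj]
    · rw [smul_inv_smul₀ h0]; abel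

theorem stmt7
    (V : Type*) [NormedAddCommGroup V] [InnerProductSpace ℝ V] [FiniteDimensional ℝ V]
    (m : ℕ) (hm : 2 ≤ m) (hdim : Module.finrank ℝ V = 2 * m)
    (J : V →ₗᵢ[ℝ] V) (hJ : ∀ x : V, J (J x) = -x)
 :
    ∀ (β : Submodule ℝ V), Module.finrank ℝ β = 2 →
      ∀ φ : ℝ, φ ∈ Set.Icc 0 (π / 2) →
      (∃ u v : V, u ∈ β ∧ v ∈ β ∧ ‖u‖ = 1 ∧ ‖v‖ = 1 ∧ ⟪u, v⟫ = 0 ∧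
        Real.cos φ = |⟪u, J v⟫|) →
      ∃ x y : V, ‖x‖ = 1 ∧ ‖y‖ = 1 ∧ ⟪x, y⟫ = 0 ∧ ⟪x, J y⟫ = 0 ∧
        x ∈ β ∧ (Real.cos φ • J x + Real.sin φ • y) ∈ β ∧
        ‖Real.cos φ • J x + Real.sin φ • y‖ = 1 ∧
        ⟪x, Real.cos φ • J x + Real.sin φ • y⟫ = 0 := by
  intro β _ φ hφ ⟨u, v, hu, hv, hu1, hv1, huv, hc⟩
  have skew : ∀ a b : V, ⟪a, J b⟫ = -⟪J a, b⟫ := by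
    intro a b
    have h := J.inner_map_map a (J b)
    rw [hJ, inner_neg_right] at h
    exact h.symm
  have hxj : ⟪u, J u⟫ = 0 := by
    have h := skew u u
    rw [real_inner_comm u (J u)] at h
    have h' := real_inner_comm u (J u)
    linarith
  have hcs : Real.cos φ ^ 2 + Real.sin φ ^ 2 = 1 := Real.cos_sq_add_sin_sq φ
  have hs0 : 0 ≤ Real.sin φ :=
    Real.sin_nonneg_of_nonneg_of_le_pi hφ.1 (by linarith [hφ.2, Real.pi_pos])
  have hc0 : 0 ≤ Real.cos φ := hc ▸ abs_nonneg _
  obtain ⟨w, hw, hw1, huw, hjw⟩ : ∃ w ∈ β, ‖w‖ = 1 ∧ ⟪u, w⟫ = 0 ∧ ⟪J u, w⟫ = Real.cos φ := by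
    rw [skew, abs_neg] at hc
    rcases abs_choice ⟪J u, v⟫ with h | h
    · exact ⟨v, hv, hv1, huv, by rw [hc, h]⟩
    · exact ⟨-v, β.neg_mem hv, by rw [norm_neg, hv1], by rw [inner_neg_right, huv, neg_zero],
        by rw [hc, h, inner_neg_right]⟩
  obtain ⟨y, h1, h2, h3, h4⟩ := exists_y (by omega) u (J u) w _ _ hcs hs0 hc0
    (by rw [J.norm_map, hu1]) hw1 hxj huw hjw
  refine ⟨u, y, hu1, h1, h2, by rw [skew, h3, neg_zero], hu, ?_, ?_, ?_⟩ <;> rw [h4] <;> assumption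
end

section
/- Let V be a real inner product space of dimension 2m with m > 2, J an orthogonal complex structure on V, R an algebraic curvature tensor on V, and fix θ ∈ (0, π/2). If hypotheses (1) and (2) hold for every admissible pair, then there exists a real constant c such that R(u, v, v, u) = c for all orthonormal vectors u, v ∈ V; equivalently, R = c·π₁, where π₁(x, y, z, u) = ⟨x, u⟩⟨y, z⟩ − ⟨x, z⟩⟨y, u⟩. -/
open scoped RealInnerProductSpace
open Real

theorem curv_zero {V : Type*} [AddCommGroup V] (T : V → V → V → V → ℝ)
    (hadd : ∀ a b y z u, T (a + b) y z u = T a y z u + T b y z u)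
    (s1 : ∀ x y z u, T x y z u = - T y x z u)
    (s2 : ∀ x y z u, T x y z u = - T x y u z)
    (s3 : ∀ x y z u, T x y z u = T z u x y)
    (hb : ∀ x y z u, T x y z u + T y z x u + T z x y u = 0)
    (h0 : ∀ x y, T x y y x = 0) (x y z u : V) : T x y z u = 0 := by
  have add2 : ∀ a b y z u, T y (a + b) z u = T y a z u + T y b z u := by
    intro a b y z u
    rw [s1, hadd, s1 y a, s1 y b]; ring
  have add3 : ∀ a b y z u, T y z (a + b) u = T y z a u + T y z b u := by
    intro a b y z u
    rw [s3, hadd, s3 y z a, s3 y z b]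
  have add4 : ∀ a b y z u, T y z u (a + b) = T y z u a + T y z u b := by
    intro a b y z u
    rw [s2, add3, s2 y z u a, s2 y z u b]; ring
  have h3 : ∀ x y z, T x y z x = 0 := by
    intro x y z
    have e := h0 x (y + z)
    simp only [add2, add3, h0] at e
    have e2 : T x z y x = T x y z x := by
      rw [s3, s1, s2]; ring
    linarith
  have h4 : ∀ x y z u, T x y z u = - T u y z x := by
    intro x y z u
    have e := h3 (x + u) y z
    simp only [hadd, add4, h3] at e
    linarith
  have e1 : T y z x u = T x y z u := by
    rw [s1 x y z u, h4 y x z u, s2 u x z y, s3 u x y z, s2 y z u x]; ring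
  have e2 : T z x y u = T x y z u := by
    rw [h4 z x y u, s3 u x y z, s2 y z u x, e1]; ring
  have := hb x y z u
  linarith

theorem stmt9
    (V : Type*) [NormedAddCommGroup V] [InnerProductSpace ℝ V] [FiniteDimensional ℝ V]
    (m : ℕ) (hm : 2 < m) (hdim : Module.finrank ℝ V = 2 * m)
    (J : V →ₗᵢ[ℝ] V) (hJ : ∀ x : V, J (J x) = -x)
    (R : V →ₗ[ℝ] V →ₗ[ℝ] V →ₗ[ℝ] V →ₗ[ℝ] ℝ)
    (hsym1 : ∀ x y z u : V, R x y z u = - R y x z u)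
    (hsym2 : ∀ x y z u : V, R x y z u = - R x y u z)
    (hsym3 : ∀ x y z u : V, R x y z u = R z u x y)
    (hbianchi : ∀ x y z u : V, R x y z u + R y z x u + R z x y u = 0)
    (θ : ℝ) (hθ : θ ∈ Set.Ioo 0 (π / 2))
    (h1 : ∀ x y : V, ‖x‖ = 1 → ‖y‖ = 1 → ⟪x, y⟫ = 0 → ⟪x, J y⟫ = 0 →
      R (Real.cos θ • J x + Real.sin θ • y) x x (J y) = 0)
    (h2 : ∀ x y : V, ‖x‖ = 1 → ‖y‖ = 1 → ⟪x, y⟫ = 0 → ⟪x, J y⟫ = 0 →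
      R (Real.cos θ • J x + Real.sin θ • y) x x (Real.sin θ • J x - Real.cos θ • y) = 0)
 :
    ∃ c : ℝ,
      (∀ u v : V, ‖u‖ = 1 → ‖v‖ = 1 → ⟪u, v⟫ = 0 → R u v v u = c) ∧
      (∀ x y z u : V, R x y z u = c * (⟪x, u⟫ * ⟪y, z⟫ - ⟪x, z⟫ * ⟪y, u⟫)) := by
  have hs : 0 < Real.sin θ := Real.sin_pos_of_pos_of_lt_pi hθ.1 (by linarith [hθ.2, Real.pi_pos])
  have hc : 0 < Real.cos θ := Real.cos_pos_of_mem_Ioo ⟨by linarith [hθ.1, Real.pi_pos], hθ.2⟩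
  have hR : ∀ x y z u, R x y z u = R u z y x := by
    intro x y z u
    rw [hsym3, hsym1, hsym2]; ring
  have hJJ : ∀ x y, ⟪J x, J y⟫ = ⟪x, y⟫ := fun x y => J.inner_map_map x y
  have hJs : ∀ x y, ⟪J x, y⟫ = - ⟪x, J y⟫ := by
    intro x y
    have := hJJ x (J y)
    rw [hJ, inner_neg_right] at this
    linarith
  have hJx : ∀ x, ⟪x, J x⟫ = 0 := by
    intro x
    have := hJs x x
    rw [real_inner_comm] at this
    linarith
  have A0 : ∀ x y : V, ‖x‖ = 1 → ‖y‖ = 1 → ⟪x, y⟫ = 0 → ⟪x, J y⟫ = 0 →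
      R (J x) x x (J y) = 0 := by
    intro x y hx hy h h'
    have e1 := h1 x y hx hy h h'
    have e2 := h1 x ((-1 : ℝ) • y) hx (by simpa using hy) (by simpa using h) (by simpa using h')
    simp only [map_add, map_smul, LinearMap.add_apply, LinearMap.smul_apply,
      smul_eq_mul] at e1 e2
    have : Real.cos θ * R (J x) x x (J y) = 0 := by linarith
    exact (mul_eq_zero.1 this).resolve_left hc.ne'
  have A : ∀ x y : V, ‖x‖ = 1 → ‖y‖ = 1 → ⟪x, y⟫ = 0 → ⟪x, J y⟫ = 0 →
      R (J x) x x y = 0 := by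
    intro x y hx hy h h'
    have := A0 x (J y) hx (by simpa using hy) h' (by simpa [hJ] using h)
    simpa [hJ] using this
  have B : ∀ x y : V, ‖x‖ = 1 → ‖y‖ = 1 → ⟪x, y⟫ = 0 → ⟪x, J y⟫ = 0 →
      R y x x y = R (J x) x x (J x) := by
    intro x y hx hy h h'
    have e1 := h2 x y hx hy h h'
    have a := A x y hx hy h h'
    have a' : R y x x (J x) = 0 := by rw [hR, a]
    simp only [map_add, map_sub, map_smul, LinearMap.add_apply, LinearMap.smul_apply,
      smul_eq_mul, a, a'] at e1
    have : (Real.cos θ * Real.sin θ) * (R (J x) x x (J x) - R y x x y) = 0 := by linarith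
    have := (mul_eq_zero.1 this).resolve_left (by positivity)
    linarith
  have H1 : ∀ x y : V, ‖x‖ = 1 → ‖y‖ = 1 → ⟪x, y⟫ = 0 → ⟪x, J y⟫ = 0 →
      R (J x) x x (J x) = R (J y) y y (J y) := by
    intro x y hx hy h h'
    rw [← B x y hx hy h h', ← B y x hy hx (by rw [real_inner_comm]; exact h)
      (by rw [real_inner_comm, hJs, h', neg_zero]), hR y, hsym1 y, hsym2 x y x y, hsym1 x y y x]
    have := hR x y x y
    have e1 := hsym1 y x x y
    have e2 := hsym2 x y x y
    linarith
  have H2 : ∀ x y : V, ‖x‖ = 1 → ‖y‖ = 1 → R (J x) x x (J x) = R (J y) y y (J y) := by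
    intro x y hx hy
    classical
    let S : Submodule ℝ V := Submodule.span ℝ (({x, J x, y, J y} : Finset V) : Set V)
    have hS : Module.finrank ℝ S ≤ 4 :=
      (finrank_span_finset_le_card _).trans Finset.card_le_four
    have hadd := S.finrank_add_finrank_orthogonal
    have hpos : 0 < Module.finrank ℝ Sᗮ := by omega
    have := Module.nontrivial_of_finrank_pos hpos
    obtain ⟨w, hw⟩ := exists_ne (0 : Sᗮ)
    have hw0 : (w : V) ≠ 0 := by simpa using hw
    have hn : ‖(w : V)‖ ≠ 0 := by simpa using hw
    have ho : ∀ v ∈ S, ⟪v, (w : V)⟫ = 0 := fun v hv => (Submodule.mem_orthogonal _ _).1 w.2 v hv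
    have hz : ‖(‖(w : V)‖⁻¹ • (w : V))‖ = 1 := by
      rw [norm_smul, norm_inv, norm_norm, inv_mul_cancel₀ hn]
    have hx1 := ho x (Submodule.subset_span (by simp))
    have hx2 := ho (J x) (Submodule.subset_span (by simp))
    have hy1 := ho y (Submodule.subset_span (by simp))
    have hy2 := ho (J y) (Submodule.subset_span (by simp))
    rw [hJs, neg_eq_zero] at hx2 hy2
    rw [H1 x _ hx hz (by simp [inner_smul_right, hx1]) (by simp [inner_smul_right, hx2]),
      H1 y _ hy hz (by simp [inner_smul_right, hy1]) (by simp [inner_smul_right, hy2])]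
  have : Nontrivial V := Module.nontrivial_of_finrank_pos (R := ℝ) (by omega)
  obtain ⟨x0, hx0⟩ := exists_norm_eq V (zero_le_one' ℝ)
  obtain ⟨c, hcdef⟩ : ∃ c, c = R (J x0) x0 x0 (J x0) := ⟨_, rfl⟩
  have Hc : ∀ x, ‖x‖ = 1 → R (J x) x x (J x) = c := fun x hx => by rw [hcdef]; exact H2 x x0 hx hx0
  have alt : ∀ x z u, R x x z u = 0 := fun x z u => by linarith [hsym1 x x z u]
  have alt' : ∀ x z u, R z u x x = 0 := fun x z u => by linarith [hsym2 z u x x]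
  have P : ∀ x w : V, ‖x‖ = 1 → ⟪x, w⟫ = 0 → ⟪x, J w⟫ = 0 →
      R (J x) x x w = 0 ∧ R w x x w = c * ⟪w, w⟫ := by
    intro x w hx h h'
    by_cases hw : w = 0
    · simp [hw]
    have hn : ‖w‖ ≠ 0 := by simpa using hw
    have hz : ‖(‖w‖⁻¹ • w)‖ = 1 := by
      rw [norm_smul, norm_inv, norm_norm, inv_mul_cancel₀ hn]
    have a := A x _ hx hz (by simp [inner_smul_right, h]) (by simp [inner_smul_right, h'])
    have b := B x _ hx hz (by simp [inner_smul_right, h]) (by simp [inner_smul_right, h'])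
    rw [Hc x hx] at b
    simp only [map_smul, LinearMap.smul_apply, smul_eq_mul] at a b
    refine ⟨(mul_eq_zero.1 a).resolve_left (inv_ne_zero hn), ?_⟩
    rw [real_inner_self_eq_norm_sq, ← b]
    field_simp
  have Q : ∀ x u : V, ‖x‖ = 1 → R u x x u = c * (⟪u, u⟫ - ⟪u, x⟫ * ⟪u, x⟫) := by
    intro x u hx
    have hxx : ⟪x, x⟫ = 1 := by rw [real_inner_self_eq_norm_sq, hx]; norm_num
    obtain ⟨a, ha⟩ : ∃ a, a = ⟪x, u⟫ := ⟨_, rfl⟩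
    obtain ⟨b, hb⟩ : ∃ b, b = ⟪J x, u⟫ := ⟨_, rfl⟩
    obtain ⟨w, hw⟩ : ∃ w, w = u - a • x - b • J x := ⟨_, rfl⟩
    have hu : u = a • x + b • J x + w := by rw [hw]; abel
    have hJxx : ⟪J x, x⟫ = 0 := by rw [hJs, hJx, neg_zero]
    have w1 : ⟪x, w⟫ = 0 := by
      rw [hw]; simp only [inner_sub_right, inner_smul_right, hxx, hJx, ← ha]; ring
    have w2 : ⟪J x, w⟫ = 0 := by
      rw [hw]; simp only [inner_sub_right, inner_smul_right, hJJ, hxx, hJxx, ← hb]; ring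
    have w3 : ⟪x, J w⟫ = 0 := by rw [hJs] at w2; linarith
    have w1' : ⟪w, x⟫ = 0 := by rw [real_inner_comm]; exact w1
    have w2' : ⟪w, J x⟫ = 0 := by rw [real_inner_comm]; exact w2
    obtain ⟨p1, p2⟩ := P x w hx w1 w3
    have p3 : R w x x (J x) = 0 := by rw [hR, p1]
    rw [hu]
    simp only [map_add, map_smul, LinearMap.add_apply, LinearMap.smul_apply, smul_eq_mul,
      inner_add_left, inner_add_right, inner_smul_left, inner_smul_right, hxx, hJx, hJxx, hJJ,
      w1, w2, w1', w2', p1, p2, p3, alt, alt', Hc x hx, RCLike.conj_to_real]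
    ring
  have Q' : ∀ u x : V, R u x x u = c * (⟪u, u⟫ * ⟪x, x⟫ - ⟪u, x⟫ * ⟪x, u⟫) := by
    intro u x
    by_cases hx : x = 0
    · simp [hx]
    have hn : ‖x‖ ≠ 0 := by simpa using hx
    have hz : ‖(‖x‖⁻¹ • x)‖ = 1 := by
      rw [norm_smul, norm_inv, norm_norm, inv_mul_cancel₀ hn]
    have q := Q _ u hz
    simp only [map_smul, LinearMap.smul_apply, smul_eq_mul, inner_smul_right] at q
    rw [real_inner_self_eq_norm_sq x, real_inner_comm u x]
    field_simp at q
    linarith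
  refine ⟨c, ?_, ?_⟩
  · intro u v hu hv huv
    rw [Q', huv, real_inner_self_eq_norm_sq, real_inner_self_eq_norm_sq, hu, hv]; ring
  · intro x y z u
    have := curv_zero (fun x y z u => R x y z u - c * (⟪x, u⟫ * ⟪y, z⟫ - ⟪x, z⟫ * ⟪y, u⟫))
      (by intro a b y z u
          simp only [map_add, LinearMap.add_apply, inner_add_left]; ring)
      (by intro x y z u
          beta_reduce
          rw [hsym1]; ring)
      (by intro x y z u
          beta_reduce
          rw [hsym2]; ring)
      (by intro x y z u
          beta_reduce
          rw [hsym3, real_inner_comm z y, real_inner_comm u x, real_inner_comm z x,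
            real_inner_comm u y]; ring)
      (by intro x y z u
          beta_reduce
          have := hbianchi x y z u
          rw [real_inner_comm x y, real_inner_comm y z, real_inner_comm z x]
          linarith)
      (by intro x y
          beta_reduce
          rw [Q']; ring) x y z u
    beta_reduce at this
    linarith
end

section
/- Let V be a real inner product space of dimension 4, J an orthogonal complex structure on V, R an algebraic curvature tensor on V, and fix θ ∈ (0, π/2). If hypotheses (1) and (2) hold for every admissible pair, then R = c·π₁, where c = R(x, Jx, Jx, x) for any unit vector x and π₁(x, y, z, u) = ⟨x, u⟩⟨y, z⟩ − ⟨x, z⟩⟨y, u⟩; that is, the tensor T = R − c·π₁ vanishes identically. -/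
set_option linter.all false
set_option linter.unusedSimpArgs false
set_option maxHeartbeats 4000000
open scoped RealInnerProductSpace
open Real

theorem antisym_ext (T : Fin 4 → Fin 4 → Fin 4 → Fin 4 → ℝ)
    (h1 : ∀ i j k l, T i j k l = - T j i k l) (h2 : ∀ i j k l, T i j k l = - T i j l k)
    (h : ∀ i j k l, i < j → k < l → T i j k l = 0) (i j k l : Fin 4) : T i j k l = 0 := by
  have key : ∀ i j k l, i < j → T i j k l = 0 := by
    intro i j k l hij
    rcases lt_trichotomy k l with hk | hk | hk
    · exact h i j k l hij hk
    · subst hk; linarith [h2 i j k k]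
    · linarith [h2 i j k l, h i j l k hij hk]
  rcases lt_trichotomy i j with hk | hk | hk
  · exact key i j k l hk
  · subst hk; linarith [h1 i i k l]
  · linarith [h1 i j k l, key j i k l hk]

theorem core_facts {V : Type*} (R : V → V → V → V → ℝ) (x X y Y : V)
    (h1 : ∀ a b c d, R a b c d = - R b a c d) (h2 : ∀ a b c d, R a b c d = - R a b d c)
    (h3 : ∀ a b c d, R a b c d = R c d a b)
    (hb : ∀ a b c d, R a b c d + R b c a d + R c a b d = 0)
    (fP1_02 : R X x x y = 0)
    (fQ1_02 : R y x x Y = 0)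
    (fP3_02 : R X x x X = R y x x y)
    (fP1_03 : R X x x Y = 0)
    (fQ1_03 : R Y x x y = 0)
    (fP3_03 : R X x x X = R Y x x Y)
    (fP1_12 : R x X X y = 0)
    (fQ1_12 : R y X X Y = 0)
    (fP3_12 : R x X X x = R y X X y)
    (fP1_13 : R x X X Y = 0)
    (fQ1_13 : R Y X X y = 0)
    (fP3_13 : R x X X x = R Y X X Y)
    (fP1_20 : R Y y y x = 0)
    (fQ1_20 : R x y y X = 0)
    (fP3_20 : R Y y y Y = R x y y x)
    (fP1_30 : R y Y Y x = 0)
    (fQ1_30 : R x Y Y X = 0)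
    (fP3_30 : R y Y Y y = R x Y Y x)
    (fP1_21 : R Y y y X = 0)
    (fQ1_21 : R X y y x = 0)
    (fP3_21 : R Y y y Y = R X y y X)
    (fP1_31 : R y Y Y X = 0)
    (fQ1_31 : R X Y Y x = 0)
    (fP3_31 : R y Y Y y = R X Y Y X)
    (g1 : R X x x X + R X x x Y + R X x y X + R X x y Y + R X y x X + R X y x Y + R X y y X + R X y y Y + R Y x x X + R Y x x Y + R Y x y X + R Y x y Y + R Y y x X + R Y y x Y + R Y y y X + R Y y y Y = R x x x x - R x x x y + R x x y x - R x x y y + R x y x x - R x y x y + R x y y x - R x y y y - R y x x x + R y x x y - R y x y x + R y x y y - R y y x x + R y y x y - R y y y x + R y y y y)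
    (g2 : R X x x X - R X x x y + R X x Y X - R X x Y y + R X Y x X - R X Y x y + R X Y Y X - R X Y Y y - R y x x X + R y x x y - R y x Y X + R y x Y y - R y Y x X + R y Y x y - R y Y Y X + R y Y Y y = R x x x x - R x x x Y + R x x Y x - R x x Y Y + R x Y x x - R x Y x Y + R x Y Y x - R x Y Y Y - R Y x x x + R Y x x Y - R Y x Y x + R Y x Y Y - R Y Y x x + R Y Y x Y - R Y Y Y x + R Y Y Y Y) :
    R x X x y = 0 ∧
    R x X x Y = 0 ∧
    R x X X y = 0 ∧
    R x X X Y = 0 ∧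
    R x X y Y = 0 ∧
    R x y x y = R x X x X ∧
    R x y x Y = 0 ∧
    R x y X y = 0 ∧
    R x y X Y = 0 ∧
    R x y y Y = 0 ∧
    R x Y x Y = R x X x X ∧
    R x Y X y = 0 ∧
    R x Y X Y = 0 ∧
    R x Y y Y = 0 ∧
    R X y X y = R x X x X ∧
    R X y X Y = 0 ∧
    R X y y Y = 0 ∧
    R X Y X Y = R x X x X ∧
    R X Y y Y = 0 ∧
    R y Y y Y = R x X x X := by
  have d1 : ∀ a b c, R a a b c = 0 := fun a b c => by linarith [h1 a a b c]
  have d2 : ∀ a b c, R b c a a = 0 := fun a b c => by linarith [h2 b c a a]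
  have hb0 := hb x X y Y
  simp only [h1 X x, h1 y x, h1 Y x, h1 y X, h1 Y X, h1 Y y, h2 _ _ X x, h2 _ _ y x, h2 _ _ Y x, h2 _ _ y X, h2 _ _ Y X, h2 _ _ Y y, h3 x y x X, h3 x Y x X, h3 X y x X, h3 X Y x X, h3 y Y x X, h3 x Y x y, h3 X y x y, h3 X Y x y, h3 y Y x y, h3 X y x Y, h3 X Y x Y, h3 y Y x Y, h3 X Y X y, h3 y Y X y, h3 y Y X Y, d1, d2, neg_neg, neg_zero, add_zero, zero_add, sub_zero, neg_eq_zero, sub_neg_eq_add] at fP1_02 fQ1_02 fP3_02 fP1_03 fQ1_03 fP3_03 fP1_12 fQ1_12 fP3_12 fP1_13 fQ1_13 fP3_13 fP1_20 fQ1_20 fP3_20 fP1_30 fQ1_30 fP3_30 fP1_21 fQ1_21 fP3_21 fP1_31 fQ1_31 fP3_31 g1 g2 hb0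
  refine ⟨?_, ?_, ?_, ?_, ?_, ?_, ?_, ?_, ?_, ?_, ?_, ?_, ?_, ?_, ?_, ?_, ?_, ?_, ?_, ?_⟩ <;> linarith

theorem stmt10
    (V : Type*) [NormedAddCommGroup V] [InnerProductSpace ℝ V] [FiniteDimensional ℝ V]
    (hdim : Module.finrank ℝ V = 4)
    (J : V →ₗᵢ[ℝ] V) (hJ : ∀ x : V, J (J x) = -x)
    (R : V →ₗ[ℝ] V →ₗ[ℝ] V →ₗ[ℝ] V →ₗ[ℝ] ℝ)
    (hsym1 : ∀ x y z u : V, R x y z u = - R y x z u)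
    (hsym2 : ∀ x y z u : V, R x y z u = - R x y u z)
    (hsym3 : ∀ x y z u : V, R x y z u = R z u x y)
    (hbianchi : ∀ x y z u : V, R x y z u + R y z x u + R z x y u = 0)
    (θ : ℝ) (hθ : θ ∈ Set.Ioo 0 (π / 2))
    (h1 : ∀ x y : V, ‖x‖ = 1 → ‖y‖ = 1 → ⟪x, y⟫ = 0 → ⟪x, J y⟫ = 0 →
      R (Real.cos θ • J x + Real.sin θ • y) x x (J y) = 0)
    (h2 : ∀ x y : V, ‖x‖ = 1 → ‖y‖ = 1 → ⟪x, y⟫ = 0 → ⟪x, J y⟫ = 0 →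
      R (Real.cos θ • J x + Real.sin θ • y) x x (Real.sin θ • J x - Real.cos θ • y) = 0)
 :
    ∀ x : V, ‖x‖ = 1 →
      ∀ a b z u : V,
        R a b z u - R x (J x) (J x) x * (⟪a, u⟫ * ⟪b, z⟫ - ⟪a, z⟫ * ⟪b, u⟫) = 0 := by
  intro x hx
  have hs : 0 < Real.sin θ := Real.sin_pos_of_pos_of_lt_pi hθ.1 (by linarith [hθ.2, Real.pi_pos])
  have hc : 0 < Real.cos θ := Real.cos_pos_of_mem_Ioo ⟨by linarith [hθ.1, Real.pi_pos], hθ.2⟩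
  have hJJ : ∀ a b : V, ⟪J a, J b⟫ = ⟪a, b⟫ := fun a b => J.inner_map_map a b
  have hJ1 : ∀ a b : V, ⟪J a, b⟫ = - ⟪a, J b⟫ := by
    intro a b
    have := hJJ a (J b)
    rw [hJ, inner_neg_right] at this
    linarith
  have hJ0 : ∀ a : V, ⟪a, J a⟫ = 0 := by
    intro a
    have := hJ1 a a
    rw [real_inner_comm] at this
    linarith
  have rn1 : ∀ a b c d : V, R (-a) b c d = - R a b c d := fun a b c d => by
    rw [hsym1, map_neg, hsym1 a b]; rfl
  have rn2 : ∀ a b c d : V, R a (-b) c d = - R a b c d := fun a b c d => by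
    rw [map_neg]; rfl
  have rn3 : ∀ a b c d : V, R a b (-c) d = - R a b c d := fun a b c d => by
    rw [map_neg]; rfl
  have ra1 : ∀ a a2 b c d : V, R (a + a2) b c d = R a b c d + R a2 b c d := fun a a2 b c d => by
    rw [map_add]; rfl
  have ra2 : ∀ a b b2 c d : V, R a (b + b2) c d = R a b c d + R a b2 c d := fun a b b2 c d => by
    rw [map_add]; rfl
  have ra3 : ∀ a b c c2 d : V, R a b (c + c2) d = R a b c d + R a b c2 d := fun a b c c2 d => by
    rw [map_add]; rfl
  have rs1 : ∀ a a2 b c d : V, R (a - a2) b c d = R a b c d - R a2 b c d := fun a a2 b c d => by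
    rw [sub_eq_add_neg, ra1, rn1]; ring
  have ra4 : ∀ a b c d d2 : V, R a b c (d + d2) = R a b c d + R a b c d2 := fun a b c d d2 => by
    rw [map_add]
  have rs4 : ∀ a b c d d2 : V, R a b c (d - d2) = R a b c d - R a b c d2 := fun a b c d d2 => by
    rw [map_sub]
  have rn4 : ∀ a b c d : V, R a b c (-d) = - R a b c d := fun a b c d => by
    rw [map_neg]
  have Q1 : ∀ x y : V, ‖x‖ = 1 → ‖y‖ = 1 → ⟪x, y⟫ = 0 → ⟪x, J y⟫ = 0 →
      R (J x) x x (J y) = 0 ∧ R y x x (J y) = 0 := by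
    intro x y hx hy h3 h4
    have e1 := h1 x y hx hy h3 h4
    have e2 := h1 x (-y) hx (by simpa using hy) (by simpa using h3) (by simpa using h4)
    simp only [map_add, map_smul, map_neg, LinearMap.add_apply, LinearMap.smul_apply,
      rn1, smul_eq_mul] at e1 e2
    constructor
    · have : Real.cos θ * R (J x) x x (J y) = 0 := by linarith
      exact (mul_eq_zero.1 this).resolve_left hc.ne'
    · have : Real.sin θ * R y x x (J y) = 0 := by linarith
      exact (mul_eq_zero.1 this).resolve_left hs.ne'
  have P1 : ∀ x y : V, ‖x‖ = 1 → ‖y‖ = 1 → ⟪x, y⟫ = 0 → ⟪x, J y⟫ = 0 →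
      R (J x) x x y = 0 := by
    intro x y hx hy h3 h4
    have := (Q1 x (J y) hx (by simpa using hy) h4 (by rw [hJ]; simpa using h3)).1
    rw [hJ] at this
    simpa using this
  have P3 : ∀ x y : V, ‖x‖ = 1 → ‖y‖ = 1 → ⟪x, y⟫ = 0 → ⟪x, J y⟫ = 0 →
      R (J x) x x (J x) = R y x x y := by
    intro x y hx hy h3 h4
    have e1 := h2 x y hx hy h3 h4
    have e2 := P1 x y hx hy h3 h4
    have e3 : R y x x (J x) = 0 := by
      linarith [hsym3 y x x (J x), hsym1 x (J x) y x, hsym2 (J x) x y x]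
    simp only [map_add, map_sub, map_smul, LinearMap.add_apply, LinearMap.smul_apply,
      smul_eq_mul, e2, e3] at e1
    have : (Real.cos θ * Real.sin θ) * (R (J x) x x (J x) - R y x x y) = 0 := by linarith
    have := (mul_eq_zero.1 this).resolve_left (mul_pos hc hs).ne'
    linarith
  have P3h : ∀ x y : V, ‖x‖ = ‖y‖ → x ≠ 0 → ⟪x, y⟫ = 0 → ⟪x, J y⟫ = 0 →
      R (J x) x x (J x) = R y x x y := by
    intro x y hxy hx0 h3 h4
    have hn : 0 < ‖x‖ := norm_pos_iff.2 hx0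
    have e := P3 (‖x‖⁻¹ • x) (‖x‖⁻¹ • y)
      (by rw [norm_smul, norm_inv, norm_norm]; field_simp)
      (by rw [norm_smul, norm_inv, norm_norm, ← hxy]; field_simp)
      (by simp [inner_smul_left, inner_smul_right, h3])
      (by simp [inner_smul_left, inner_smul_right, h4])
    simp only [map_smul, LinearMap.smul_apply, smul_eq_mul] at e
    have hk : (‖x‖⁻¹) ≠ 0 := (inv_pos.2 hn).ne'
    exact mul_left_cancel₀ hk (mul_left_cancel₀ hk (mul_left_cancel₀ hk (mul_left_cancel₀ hk e)))
  obtain ⟨y, hy, hxy, hxJy⟩ : ∃ y : V, ‖y‖ = 1 ∧ ⟪x, y⟫ = 0 ∧ ⟪x, J y⟫ = 0 := by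
    classical
    have hlt : Module.finrank ℝ (Submodule.span ℝ ({x, J x} : Set V)) < Module.finrank ℝ V := by
      have h := finrank_span_finset_le_card (R := ℝ) (M := V) {x, J x}
      have h2 := (h.trans Finset.card_le_two)
      rw [hdim]
      have : Module.finrank ℝ (Submodule.span ℝ ({x, J x} : Set V)) ≤ 2 := by
        rw [Finset.coe_pair] at h2
        exact h2
      omega
    have hne : (Submodule.span ℝ ({x, J x} : Set V))ᗮ ≠ ⊥ := by
      intro hb
      rw [Submodule.orthogonal_eq_bot_iff] at hb
      rw [hb, finrank_top] at hlt
      exact lt_irrefl _ hlt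
    obtain ⟨w, hw, hw0⟩ := Submodule.exists_mem_ne_zero_of_ne_bot hne
    rw [Submodule.mem_orthogonal] at hw
    have w1 := hw x (Submodule.subset_span (by simp))
    have w2 := hw (J x) (Submodule.subset_span (by simp))
    rw [hJ1] at w2
    have hn : 0 < ‖w‖ := norm_pos_iff.2 hw0
    refine ⟨‖w‖⁻¹ • w, ?_, ?_, ?_⟩
    · rw [norm_smul, norm_inv, norm_norm]; field_simp
    · simp [inner_smul_right, w1]
    · have : ⟪x, J w⟫ = 0 := by linarith
      simp [inner_smul_right, this]
  have nJ : ∀ a : V, ‖J a‖ = ‖a‖ := J.norm_map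
  have hyx : ⟪y, x⟫ = 0 := by rw [real_inner_comm]; exact hxy
  have hyJx : ⟪y, J x⟫ = 0 := by rw [real_inner_comm, hJ1, hxJy, neg_zero]
  have ixx : ⟪x, x⟫ = 1 := by rw [real_inner_self_eq_norm_sq, hx]; norm_num
  have iyy : ⟪y, y⟫ = 1 := by rw [real_inner_self_eq_norm_sq, hy]; norm_num
  let e : Fin 4 → V := ![x, J x, y, J y]
  have hon : Orthonormal ℝ e := by
    rw [orthonormal_iff_ite]
    intro i j
    fin_cases i <;> fin_cases j <;>
      simp [e, hJJ, hJ1, hJ0, hxy, hxJy, hyx, hyJx, hx, hy, hJ, ixx, iyy]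
  have fP1_02 := P1 x y (by simp [nJ, hx, hy, hJ, hJJ, hJ1, hJ0, hxy, hxJy, hyx, hyJx]) (by simp [nJ, hx, hy, hJ, hJJ, hJ1, hJ0, hxy, hxJy, hyx, hyJx]) (by simp [nJ, hx, hy, hJ, hJJ, hJ1, hJ0, hxy, hxJy, hyx, hyJx]) (by simp [nJ, hx, hy, hJ, hJJ, hJ1, hJ0, hxy, hxJy, hyx, hyJx])
  have fQ1_02 := (Q1 x y (by simp [nJ, hx, hy, hJ, hJJ, hJ1, hJ0, hxy, hxJy, hyx, hyJx]) (by simp [nJ, hx, hy, hJ, hJJ, hJ1, hJ0, hxy, hxJy, hyx, hyJx]) (by simp [nJ, hx, hy, hJ, hJJ, hJ1, hJ0, hxy, hxJy, hyx, hyJx]) (by simp [nJ, hx, hy, hJ, hJJ, hJ1, hJ0, hxy, hxJy, hyx, hyJx])).2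
  have fP3_02 := P3 x y (by simp [nJ, hx, hy, hJ, hJJ, hJ1, hJ0, hxy, hxJy, hyx, hyJx]) (by simp [nJ, hx, hy, hJ, hJJ, hJ1, hJ0, hxy, hxJy, hyx, hyJx]) (by simp [nJ, hx, hy, hJ, hJJ, hJ1, hJ0, hxy, hxJy, hyx, hyJx]) (by simp [nJ, hx, hy, hJ, hJJ, hJ1, hJ0, hxy, hxJy, hyx, hyJx])
  have fP1_03 := P1 x (J y) (by simp [nJ, hx, hy, hJ, hJJ, hJ1, hJ0, hxy, hxJy, hyx, hyJx]) (by simp [nJ, hx, hy, hJ, hJJ, hJ1, hJ0, hxy, hxJy, hyx, hyJx]) (by simp [nJ, hx, hy, hJ, hJJ, hJ1, hJ0, hxy, hxJy, hyx, hyJx]) (by simp [nJ, hx, hy, hJ, hJJ, hJ1, hJ0, hxy, hxJy, hyx, hyJx])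
  have fQ1_03 := (Q1 x (J y) (by simp [nJ, hx, hy, hJ, hJJ, hJ1, hJ0, hxy, hxJy, hyx, hyJx]) (by simp [nJ, hx, hy, hJ, hJJ, hJ1, hJ0, hxy, hxJy, hyx, hyJx]) (by simp [nJ, hx, hy, hJ, hJJ, hJ1, hJ0, hxy, hxJy, hyx, hyJx]) (by simp [nJ, hx, hy, hJ, hJJ, hJ1, hJ0, hxy, hxJy, hyx, hyJx])).2
  have fP3_03 := P3 x (J y) (by simp [nJ, hx, hy, hJ, hJJ, hJ1, hJ0, hxy, hxJy, hyx, hyJx]) (by simp [nJ, hx, hy, hJ, hJJ, hJ1, hJ0, hxy, hxJy, hyx, hyJx]) (by simp [nJ, hx, hy, hJ, hJJ, hJ1, hJ0, hxy, hxJy, hyx, hyJx]) (by simp [nJ, hx, hy, hJ, hJJ, hJ1, hJ0, hxy, hxJy, hyx, hyJx])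
  have fP1_12 := P1 (J x) y (by simp [nJ, hx, hy, hJ, hJJ, hJ1, hJ0, hxy, hxJy, hyx, hyJx]) (by simp [nJ, hx, hy, hJ, hJJ, hJ1, hJ0, hxy, hxJy, hyx, hyJx]) (by simp [nJ, hx, hy, hJ, hJJ, hJ1, hJ0, hxy, hxJy, hyx, hyJx]) (by simp [nJ, hx, hy, hJ, hJJ, hJ1, hJ0, hxy, hxJy, hyx, hyJx])
  have fQ1_12 := (Q1 (J x) y (by simp [nJ, hx, hy, hJ, hJJ, hJ1, hJ0, hxy, hxJy, hyx, hyJx]) (by simp [nJ, hx, hy, hJ, hJJ, hJ1, hJ0, hxy, hxJy, hyx, hyJx]) (by simp [nJ, hx, hy, hJ, hJJ, hJ1, hJ0, hxy, hxJy, hyx, hyJx]) (by simp [nJ, hx, hy, hJ, hJJ, hJ1, hJ0, hxy, hxJy, hyx, hyJx])).2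
  have fP3_12 := P3 (J x) y (by simp [nJ, hx, hy, hJ, hJJ, hJ1, hJ0, hxy, hxJy, hyx, hyJx]) (by simp [nJ, hx, hy, hJ, hJJ, hJ1, hJ0, hxy, hxJy, hyx, hyJx]) (by simp [nJ, hx, hy, hJ, hJJ, hJ1, hJ0, hxy, hxJy, hyx, hyJx]) (by simp [nJ, hx, hy, hJ, hJJ, hJ1, hJ0, hxy, hxJy, hyx, hyJx])
  have fP1_13 := P1 (J x) (J y) (by simp [nJ, hx, hy, hJ, hJJ, hJ1, hJ0, hxy, hxJy, hyx, hyJx]) (by simp [nJ, hx, hy, hJ, hJJ, hJ1, hJ0, hxy, hxJy, hyx, hyJx]) (by simp [nJ, hx, hy, hJ, hJJ, hJ1, hJ0, hxy, hxJy, hyx, hyJx]) (by simp [nJ, hx, hy, hJ, hJJ, hJ1, hJ0, hxy, hxJy, hyx, hyJx])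
  have fQ1_13 := (Q1 (J x) (J y) (by simp [nJ, hx, hy, hJ, hJJ, hJ1, hJ0, hxy, hxJy, hyx, hyJx]) (by simp [nJ, hx, hy, hJ, hJJ, hJ1, hJ0, hxy, hxJy, hyx, hyJx]) (by simp [nJ, hx, hy, hJ, hJJ, hJ1, hJ0, hxy, hxJy, hyx, hyJx]) (by simp [nJ, hx, hy, hJ, hJJ, hJ1, hJ0, hxy, hxJy, hyx, hyJx])).2
  have fP3_13 := P3 (J x) (J y) (by simp [nJ, hx, hy, hJ, hJJ, hJ1, hJ0, hxy, hxJy, hyx, hyJx]) (by simp [nJ, hx, hy, hJ, hJJ, hJ1, hJ0, hxy, hxJy, hyx, hyJx]) (by simp [nJ, hx, hy, hJ, hJJ, hJ1, hJ0, hxy, hxJy, hyx, hyJx]) (by simp [nJ, hx, hy, hJ, hJJ, hJ1, hJ0, hxy, hxJy, hyx, hyJx])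
  have fP1_20 := P1 y x (by simp [nJ, hx, hy, hJ, hJJ, hJ1, hJ0, hxy, hxJy, hyx, hyJx]) (by simp [nJ, hx, hy, hJ, hJJ, hJ1, hJ0, hxy, hxJy, hyx, hyJx]) (by simp [nJ, hx, hy, hJ, hJJ, hJ1, hJ0, hxy, hxJy, hyx, hyJx]) (by simp [nJ, hx, hy, hJ, hJJ, hJ1, hJ0, hxy, hxJy, hyx, hyJx])
  have fQ1_20 := (Q1 y x (by simp [nJ, hx, hy, hJ, hJJ, hJ1, hJ0, hxy, hxJy, hyx, hyJx]) (by simp [nJ, hx, hy, hJ, hJJ, hJ1, hJ0, hxy, hxJy, hyx, hyJx]) (by simp [nJ, hx, hy, hJ, hJJ, hJ1, hJ0, hxy, hxJy, hyx, hyJx]) (by simp [nJ, hx, hy, hJ, hJJ, hJ1, hJ0, hxy, hxJy, hyx, hyJx])).2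
  have fP3_20 := P3 y x (by simp [nJ, hx, hy, hJ, hJJ, hJ1, hJ0, hxy, hxJy, hyx, hyJx]) (by simp [nJ, hx, hy, hJ, hJJ, hJ1, hJ0, hxy, hxJy, hyx, hyJx]) (by simp [nJ, hx, hy, hJ, hJJ, hJ1, hJ0, hxy, hxJy, hyx, hyJx]) (by simp [nJ, hx, hy, hJ, hJJ, hJ1, hJ0, hxy, hxJy, hyx, hyJx])
  have fP1_30 := P1 (J y) x (by simp [nJ, hx, hy, hJ, hJJ, hJ1, hJ0, hxy, hxJy, hyx, hyJx]) (by simp [nJ, hx, hy, hJ, hJJ, hJ1, hJ0, hxy, hxJy, hyx, hyJx]) (by simp [nJ, hx, hy, hJ, hJJ, hJ1, hJ0, hxy, hxJy, hyx, hyJx]) (by simp [nJ, hx, hy, hJ, hJJ, hJ1, hJ0, hxy, hxJy, hyx, hyJx])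
  have fQ1_30 := (Q1 (J y) x (by simp [nJ, hx, hy, hJ, hJJ, hJ1, hJ0, hxy, hxJy, hyx, hyJx]) (by simp [nJ, hx, hy, hJ, hJJ, hJ1, hJ0, hxy, hxJy, hyx, hyJx]) (by simp [nJ, hx, hy, hJ, hJJ, hJ1, hJ0, hxy, hxJy, hyx, hyJx]) (by simp [nJ, hx, hy, hJ, hJJ, hJ1, hJ0, hxy, hxJy, hyx, hyJx])).2
  have fP3_30 := P3 (J y) x (by simp [nJ, hx, hy, hJ, hJJ, hJ1, hJ0, hxy, hxJy, hyx, hyJx]) (by simp [nJ, hx, hy, hJ, hJJ, hJ1, hJ0, hxy, hxJy, hyx, hyJx]) (by simp [nJ, hx, hy, hJ, hJJ, hJ1, hJ0, hxy, hxJy, hyx, hyJx]) (by simp [nJ, hx, hy, hJ, hJJ, hJ1, hJ0, hxy, hxJy, hyx, hyJx])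
  have fP1_21 := P1 y (J x) (by simp [nJ, hx, hy, hJ, hJJ, hJ1, hJ0, hxy, hxJy, hyx, hyJx]) (by simp [nJ, hx, hy, hJ, hJJ, hJ1, hJ0, hxy, hxJy, hyx, hyJx]) (by simp [nJ, hx, hy, hJ, hJJ, hJ1, hJ0, hxy, hxJy, hyx, hyJx]) (by simp [nJ, hx, hy, hJ, hJJ, hJ1, hJ0, hxy, hxJy, hyx, hyJx])
  have fQ1_21 := (Q1 y (J x) (by simp [nJ, hx, hy, hJ, hJJ, hJ1, hJ0, hxy, hxJy, hyx, hyJx]) (by simp [nJ, hx, hy, hJ, hJJ, hJ1, hJ0, hxy, hxJy, hyx, hyJx]) (by simp [nJ, hx, hy, hJ, hJJ, hJ1, hJ0, hxy, hxJy, hyx, hyJx]) (by simp [nJ, hx, hy, hJ, hJJ, hJ1, hJ0, hxy, hxJy, hyx, hyJx])).2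
  have fP3_21 := P3 y (J x) (by simp [nJ, hx, hy, hJ, hJJ, hJ1, hJ0, hxy, hxJy, hyx, hyJx]) (by simp [nJ, hx, hy, hJ, hJJ, hJ1, hJ0, hxy, hxJy, hyx, hyJx]) (by simp [nJ, hx, hy, hJ, hJJ, hJ1, hJ0, hxy, hxJy, hyx, hyJx]) (by simp [nJ, hx, hy, hJ, hJJ, hJ1, hJ0, hxy, hxJy, hyx, hyJx])
  have fP1_31 := P1 (J y) (J x) (by simp [nJ, hx, hy, hJ, hJJ, hJ1, hJ0, hxy, hxJy, hyx, hyJx]) (by simp [nJ, hx, hy, hJ, hJJ, hJ1, hJ0, hxy, hxJy, hyx, hyJx]) (by simp [nJ, hx, hy, hJ, hJJ, hJ1, hJ0, hxy, hxJy, hyx, hyJx]) (by simp [nJ, hx, hy, hJ, hJJ, hJ1, hJ0, hxy, hxJy, hyx, hyJx])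
  have fQ1_31 := (Q1 (J y) (J x) (by simp [nJ, hx, hy, hJ, hJJ, hJ1, hJ0, hxy, hxJy, hyx, hyJx]) (by simp [nJ, hx, hy, hJ, hJJ, hJ1, hJ0, hxy, hxJy, hyx, hyJx]) (by simp [nJ, hx, hy, hJ, hJJ, hJ1, hJ0, hxy, hxJy, hyx, hyJx]) (by simp [nJ, hx, hy, hJ, hJJ, hJ1, hJ0, hxy, hxJy, hyx, hyJx])).2
  have fP3_31 := P3 (J y) (J x) (by simp [nJ, hx, hy, hJ, hJJ, hJ1, hJ0, hxy, hxJy, hyx, hyJx]) (by simp [nJ, hx, hy, hJ, hJJ, hJ1, hJ0, hxy, hxJy, hyx, hyJx]) (by simp [nJ, hx, hy, hJ, hJJ, hJ1, hJ0, hxy, hxJy, hyx, hyJx]) (by simp [nJ, hx, hy, hJ, hJJ, hJ1, hJ0, hxy, hxJy, hyx, hyJx])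
  simp only [hJ, rn1, rn2, rn3, map_neg, neg_neg, neg_eq_zero] at fP1_02 fQ1_02 fP3_02 fP1_03 fQ1_03 fP3_03 fP1_12 fQ1_12 fP3_12 fP1_13 fQ1_13 fP3_13 fP1_20 fQ1_20 fP3_20 fP1_30 fQ1_30 fP3_30 fP1_21 fQ1_21 fP3_21 fP1_31 fQ1_31 fP3_31
  have g1 := P3h (x + y) (x - y)
    (by
      have e1 := norm_add_sq_real x (y)
      have e2 := norm_sub_sq_real x (y)
      simp only [hxy, hxJy] at e1 e2
      exact (sq_eq_sq₀ (norm_nonneg _) (norm_nonneg _)).1 (by linarith))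
    (by
      intro h0
      have := congrArg (fun v => ⟪x, v⟫) h0
      simp [inner_add_right, ixx, hxy, hxJy, hx] at this)
    (by simp [inner_add_left, inner_sub_right, nJ, hx, hy, hxy, hxJy, hyx, hJ1, hyJx])
    (by simp [inner_add_left, inner_add_right, inner_sub_right, nJ, hx, hy, hJ, hJJ, hJ0, hxy, hxJy, hyx, hJ1, hyJx])
  have g2 := P3h (x + J y) (x - J y)
    (by
      have e1 := norm_add_sq_real x (J y)
      have e2 := norm_sub_sq_real x (J y)
      simp only [hxy, hxJy] at e1 e2
      exact (sq_eq_sq₀ (norm_nonneg _) (norm_nonneg _)).1 (by linarith))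
    (by
      intro h0
      have := congrArg (fun v => ⟪x, v⟫) h0
      simp [inner_add_right, ixx, hxy, hxJy, hx] at this)
    (by simp [inner_add_left, inner_sub_right, nJ, hx, hy, hxy, hxJy, hyx, hJ1, hyJx])
    (by simp [inner_add_left, inner_add_right, inner_sub_right, nJ, hx, hy, hJ, hJJ, hJ0, hxy, hxJy, hyx, hJ1, hyJx])
  simp only [hJ, map_add J, ra1, ra2, ra3, ra4, rs1, rs4, rn1, rn2, rn3, rn4] at g1 g2
  obtain ⟨t0102, t0103, t0112, t0113, t0123, t0202, t0203, t0212, t0213, t0223, t0303, t0312, t0313, t0323, t1212, t1213, t1223, t1313, t1323, t2323⟩ :=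
    core_facts (fun a b c d => R a b c d) x (J x) y (J y) hsym1 hsym2 hsym3 hbianchi
      (by linarith only [fP1_02])
      (by linarith only [fQ1_02])
      (by linarith only [fP3_02])
      (by linarith only [fP1_03])
      (by linarith only [fQ1_03])
      (by linarith only [fP3_03])
      (by linarith only [fP1_12])
      (by linarith only [fQ1_12])
      (by linarith only [fP3_12])
      (by linarith only [fP1_13])
      (by linarith only [fQ1_13])
      (by linarith only [fP3_13])
      (by linarith only [fP1_20])
      (by linarith only [fQ1_20])
      (by linarith only [fP3_20])
      (by linarith only [fP1_30])
      (by linarith only [fQ1_30])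
      (by linarith only [fP3_30])
      (by linarith only [fP1_21])
      (by linarith only [fQ1_21])
      (by linarith only [fP3_21])
      (by linarith only [fP1_31])
      (by linarith only [fQ1_31])
      (by linarith only [fP3_31])
      (by linarith only [g1])
      (by linarith only [g2])
  have hT := antisym_ext (fun i j k l => R (e i) (e j) (e k) (e l) - R x (J x) (J x) x *
      (⟪e i, e l⟫ * ⟪e j, e k⟫ - ⟪e i, e k⟫ * ⟪e j, e l⟫))
    (by intro i j k l; rw [hsym1 (e i) (e j)]; ring)
    (by intro i j k l; rw [hsym2 (e i) (e j)]; ring)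
    (by
      intro i j k l hij hkl
      have ho := orthonormal_iff_ite.1 hon
      simp only [ho]
      have hc0 : R x (J x) (J x) x = - R x (J x) x (J x) := hsym2 _ _ _ _
      have hs3 := hsym3 (e i) (e j) (e k) (e l)
      fin_cases i <;> fin_cases j <;> first | (exact absurd hij (by decide)) | skip
      all_goals fin_cases k <;> fin_cases l <;> first | (exact absurd hkl (by decide)) | skip
      all_goals
        simp [e] at hs3 ⊢
        linarith only [hs3, hc0, t0102, t0103, t0112, t0113, t0123, t0202, t0203, t0212, t0213, t0223, t0303, t0312, t0313, t0323, t1212, t1213, t1223, t1313, t1323, t2323])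
  have hcard : Fintype.card (Fin 4) = Module.finrank ℝ V := by simp [hdim]
  let bs := basisOfOrthonormalOfCardEqFinrank hon hcard
  have hb : ∀ i, bs i = e i := fun i => by simp [bs]
  have ind : ∀ f : V →ₗ[ℝ] ℝ, (∀ i, f (e i) = 0) → ∀ v, f v = 0 := by
    intro f hf v
    have : f = 0 := bs.ext (fun i => by rw [hb, hf]; rfl)
    rw [this]; rfl
  intro a b z u
  generalize R x (J x) (J x) x = c at hT ⊢
  let I : V →ₗ[ℝ] V →ₗ[ℝ] ℝ := innerₗ V
  have hI : ∀ p q : V, I p q = ⟪p, q⟫ := fun p q => rfl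
  have hI2 : ∀ p q : V, I.flip p q = ⟪q, p⟫ := fun p q => rfl
  have s1 : ∀ i j k, R (e i) (e j) (e k) u - c *
      (⟪e i, u⟫ * ⟪e j, e k⟫ - ⟪e i, e k⟫ * ⟪e j, u⟫) = 0 := fun i j k => by
    have := ind (R (e i) (e j) (e k) - c • (⟪e j, e k⟫ • I (e i) - ⟪e i, e k⟫ • I (e j)))
      (fun l => by
        simp only [LinearMap.sub_apply, LinearMap.smul_apply, smul_eq_mul, hI]
        linarith [hT i j k l]) u
    simp only [LinearMap.sub_apply, LinearMap.smul_apply, smul_eq_mul, hI] at this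
    linarith
  have s2 : ∀ i j, R (e i) (e j) z u - c *
      (⟪e i, u⟫ * ⟪e j, z⟫ - ⟪e i, z⟫ * ⟪e j, u⟫) = 0 := fun i j => by
    have := ind ((R (e i) (e j)).flip u - c • (⟪e i, u⟫ • I (e j) - ⟪e j, u⟫ • I (e i)))
      (fun l => by
        simp only [LinearMap.sub_apply, LinearMap.smul_apply, smul_eq_mul, hI,
          LinearMap.flip_apply]
        linarith [s1 i j l]) z
    simp only [LinearMap.sub_apply, LinearMap.smul_apply, smul_eq_mul, hI,
      LinearMap.flip_apply] at this
    linarith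
  have s3 : ∀ i, R (e i) b z u - c *
      (⟪e i, u⟫ * ⟪b, z⟫ - ⟪e i, z⟫ * ⟪b, u⟫) = 0 := fun i => by
    have := ind (((R (e i)).flip z).flip u - c • (⟪e i, u⟫ • I.flip z - ⟪e i, z⟫ • I.flip u))
      (fun l => by
        simp only [LinearMap.sub_apply, LinearMap.smul_apply, smul_eq_mul, hI2,
          LinearMap.flip_apply]
        linarith [s2 i l]) b
    simp only [LinearMap.sub_apply, LinearMap.smul_apply, smul_eq_mul, hI,
      LinearMap.flip_apply] at this
    linarith
  have := ind (((R.flip b).flip z).flip u - c • (⟪b, z⟫ • I.flip u - ⟪b, u⟫ • I.flip z))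
      (fun l => by
        simp only [LinearMap.sub_apply, LinearMap.smul_apply, smul_eq_mul, hI2,
          LinearMap.flip_apply]
        linarith [s3 l]) a
  simp only [LinearMap.sub_apply, LinearMap.smul_apply, smul_eq_mul, hI,
      LinearMap.flip_apply] at this
  linarith
end

section
/- Let V be a real inner product space of dimension 2m with m ≥ 2, J an orthogonal complex structure on V, R an algebraic curvature tensor on V, and fix θ ∈ (0, π/2). If hypotheses (1) and (2) hold for every admissible pair, then there exists a real constant c such that R = c·π₁, where π₁(x, y, z, u) = ⟨x, u⟩⟨y, z⟩ − ⟨x, z⟩⟨y, u⟩; that is, R has constant sectional curvature c. -/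
open scoped RealInnerProductSpace
open Real

theorem stmt11
    (V : Type*) [NormedAddCommGroup V] [InnerProductSpace ℝ V] [FiniteDimensional ℝ V]
    (m : ℕ) (hm : 2 ≤ m) (hdim : Module.finrank ℝ V = 2 * m)
    (J : V →ₗᵢ[ℝ] V) (hJ : ∀ x : V, J (J x) = -x)
    (R : V →ₗ[ℝ] V →ₗ[ℝ] V →ₗ[ℝ] V →ₗ[ℝ] ℝ)
    (hsym1 : ∀ x y z u : V, R x y z u = - R y x z u)
    (hsym2 : ∀ x y z u : V, R x y z u = - R x y u z)
    (hsym3 : ∀ x y z u : V, R x y z u = R z u x y)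
    (hbianchi : ∀ x y z u : V, R x y z u + R y z x u + R z x y u = 0)
    (θ : ℝ) (hθ : θ ∈ Set.Ioo 0 (π / 2))
    (h1 : ∀ x y : V, ‖x‖ = 1 → ‖y‖ = 1 → ⟪x, y⟫ = 0 → ⟪x, J y⟫ = 0 →
      R (Real.cos θ • J x + Real.sin θ • y) x x (J y) = 0)
    (h2 : ∀ x y : V, ‖x‖ = 1 → ‖y‖ = 1 → ⟪x, y⟫ = 0 → ⟪x, J y⟫ = 0 →
      R (Real.cos θ • J x + Real.sin θ • y) x x (Real.sin θ • J x - Real.cos θ • y) = 0)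
 :
    ∃ c : ℝ,
      ∀ x y z u : V, R x y z u = c * (⟪x, u⟫ * ⟪y, z⟫ - ⟪x, z⟫ * ⟪y, u⟫) := by
  have hs : 0 < Real.sin θ := Real.sin_pos_of_pos_of_lt_pi hθ.1 (by linarith [hθ.2, Real.pi_pos])
  have hc : 0 < Real.cos θ := Real.cos_pos_of_mem_Ioo ⟨by linarith [hθ.1, Real.pi_pos], hθ.2⟩
  have hJJ : ∀ x y : V, ⟪J x, J y⟫ = ⟪x, y⟫ := fun x y => J.inner_map_map x y
  have hJs : ∀ x y : V, ⟪J x, y⟫ = -⟪x, J y⟫ := by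
    intro x y
    have := hJJ x (J y)
    rw [hJ, inner_neg_right] at this
    linarith
  have hJself : ∀ x : V, ⟪x, J x⟫ = 0 := by
    intro x
    have := hJs x x
    rw [real_inner_comm] at this
    linarith
  -- consequences of h1, h2
  have a1 : ∀ x y : V, ‖x‖ = 1 → ‖y‖ = 1 → ⟪x, y⟫ = 0 → ⟪x, J y⟫ = 0 → R (J x) x x (J y) = 0 := by
    intro x y hx hy hxy hxJ
    have e1 := h1 x y hx hy hxy hxJ
    have e2 := h1 x (-y) hx (by simpa using hy) (by simpa using hxy) (by simpa using hxJ)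
    rw [smul_neg, ← neg_smul, map_neg, map_neg, neg_eq_zero] at e2
    simp only [map_add, map_smul, LinearMap.add_apply, LinearMap.smul_apply,
      smul_eq_mul] at e1 e2
    have : Real.cos θ * R (J x) x x (J y) = 0 := by linarith
    exact (mul_eq_zero.mp this).resolve_left hc.ne'
  have a2 : ∀ x y : V, ‖x‖ = 1 → ‖y‖ = 1 → ⟪x, y⟫ = 0 → ⟪x, J y⟫ = 0 → R (J x) x x y = 0 := by
    intro x y hx hy hxy hxJ
    have := a1 x (J y) hx (by simpa using hy) hxJ (by rw [hJ]; simpa using hxy)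
    rw [hJ, map_neg] at this
    linarith
  have a3 : ∀ x y : V, ‖x‖ = 1 → ‖y‖ = 1 → ⟪x, y⟫ = 0 → ⟪x, J y⟫ = 0 →
      R y x x y = R (J x) x x (J x) := by
    intro x y hx hy hxy hxJ
    have e1 := h2 x y hx hy hxy hxJ
    have e2 := a2 x y hx hy hxy hxJ
    have e3 : R y x x (J x) = 0 := by
      rw [hsym3, hsym1, hsym2]; linarith
    simp only [map_add, map_sub, map_smul, LinearMap.add_apply, LinearMap.smul_apply,
      smul_eq_mul, e2, e3] at e1
    have : (Real.cos θ * Real.sin θ) * (R (J x) x x (J x) - R y x x y) = 0 := by linarith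
    have := (mul_eq_zero.mp this).resolve_left (mul_pos hc hs).ne'
    linarith
  have hpair : ∀ x y z : V, R y x x z = R z x x y := by
    intro x y z
    rw [hsym3 y x x z, hsym1, hsym2]; ring
  -- all directions
  have b1 : ∀ x w : V, ‖x‖ = 1 → ⟪x, w⟫ = 0 → ⟪x, J w⟫ = 0 →
      R (J x) x x w = 0 ∧ R w x x w = ‖w‖ ^ 2 * R (J x) x x (J x) := by
    intro x w hx hxw hxJ
    by_cases hw : w = 0
    · subst hw; simp
    have hn : ‖w‖ ≠ 0 := norm_ne_zero_iff.mpr hw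
    obtain ⟨v, hv, hwv⟩ : ∃ v : V, ‖v‖ = 1 ∧ v = ‖w‖⁻¹ • w :=
      ⟨_, by rw [norm_smul, norm_inv, norm_norm, inv_mul_cancel₀ hn], rfl⟩
    have p1 : ⟪x, v⟫ = 0 := by rw [hwv, inner_smul_right, hxw, mul_zero]
    have p2 : ⟪x, J v⟫ = 0 := by rw [hwv, map_smul, inner_smul_right, hxJ, mul_zero]
    have hwe : w = ‖w‖ • v := by rw [hwv, smul_smul, mul_inv_cancel₀ hn, one_smul]
    have q1 := a2 x v hx hv p1 p2
    have q2 := a3 x v hx hv p1 p2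
    generalize ‖w‖ = t at hwe
    subst hwe
    constructor
    · simp [q1]
    · simp only [map_smul, LinearMap.smul_apply, smul_eq_mul, q2]; ring
  have b2 : ∀ x y : V, ‖x‖ = 1 → ⟪x, y⟫ = 0 → R y x x y = ‖y‖ ^ 2 * R (J x) x x (J x) := by
    intro x y hx hxy
    obtain ⟨w, hw⟩ : ∃ w : V, w = y - ⟪J x, y⟫ • J x := ⟨_, rfl⟩
    have hJx : ⟪J x, J x⟫ = 1 := by rw [hJJ, real_inner_self_eq_norm_sq, hx]; norm_num
    have p1 : ⟪x, w⟫ = 0 := by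
      rw [hw, inner_sub_right, inner_smul_right, hJself, hxy]; ring
    have p0 : ⟪J x, w⟫ = 0 := by
      rw [hw, inner_sub_right, inner_smul_right, hJx]; ring
    have p2 : ⟪x, J w⟫ = 0 := by
      have := hJs x w
      linarith
    obtain ⟨q1, q2⟩ := b1 x w hx p1 p2
    have hy : y = ⟪J x, y⟫ • J x + w := by rw [hw]; abel
    have hq := hpair x w (J x)
    generalize ⟪J x, y⟫ = t at hy
    subst hy
    have hn : ‖t • J x + w‖ ^ 2 = t ^ 2 + ‖w‖ ^ 2 := by
      rw [← real_inner_self_eq_norm_sq, ← real_inner_self_eq_norm_sq]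
      simp only [inner_add_left, inner_add_right, real_inner_smul_left, real_inner_smul_right, hJx,
        p0, real_inner_comm (J x) w]
      ring
    rw [hn]
    simp only [map_add, map_smul, LinearMap.add_apply, LinearMap.smul_apply, smul_eq_mul, q1, q2, hq]
    ring
  have hperp : ∀ x y : V, ∃ z : V, ‖z‖ = 1 ∧ ⟪x, z⟫ = 0 ∧ ⟪y, z⟫ = 0 := by
    classical
    intro x y
    have hne : (Submodule.span ℝ ({x, y} : Set V)) ≠ ⊤ := by
      intro h
      have h3 := finrank_span_finset_le_card (R := ℝ) (M := V) ({x, y} : Finset V)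
      have h5 := Finset.card_le_two (a := x) (b := y)
      rw [Set.finrank, Finset.coe_pair, h, finrank_top, hdim] at h3
      omega
    have hb : (Submodule.span ℝ ({x, y} : Set V))ᗮ ≠ ⊥ := by
      intro h
      exact hne ((Submodule.orthogonal_eq_bot_iff).mp h)
    obtain ⟨z, hz, hz0⟩ := Submodule.exists_mem_ne_zero_of_ne_bot hb
    rw [Submodule.mem_orthogonal] at hz
    refine ⟨‖z‖⁻¹ • z, ?_, ?_, ?_⟩
    · rw [norm_smul, norm_inv, norm_norm, inv_mul_cancel₀ (norm_ne_zero_iff.mpr hz0)]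
    · rw [inner_smul_right, hz x (Submodule.subset_span (by simp)), mul_zero]
    · rw [inner_smul_right, hz y (Submodule.subset_span (by simp)), mul_zero]
  have hsw : ∀ x y : V, R y x x y = R x y y x := by
    intro x y
    rw [hsym1, hsym2]; ring
  have b3 : ∀ x y : V, ‖x‖ = 1 → ‖y‖ = 1 → ⟪x, y⟫ = 0 →
      R (J x) x x (J x) = R (J y) y y (J y) := by
    intro x y hx hy hxy
    have e1 := b2 x y hx hxy
    have e2 := b2 y x hy (by rw [real_inner_comm]; exact hxy)
    rw [hx] at e2
    rw [hy] at e1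
    have := hsw x y
    linarith
  obtain ⟨x0, hx0, -, -⟩ := hperp 0 0
  obtain ⟨k, hk⟩ : ∃ k, k = R (J x0) x0 x0 (J x0) := ⟨_, rfl⟩
  have b4 : ∀ x : V, ‖x‖ = 1 → R (J x) x x (J x) = k := by
    intro x hx
    obtain ⟨z, hz, hxz, h0z⟩ := hperp x x0
    rw [hk, b3 x z hx hz hxz, b3 x0 z hx0 hz h0z]
  have b5 : ∀ x y : V, ‖x‖ = 1 → R y x x y = k * (⟪y, y⟫ - ⟪x, y⟫ ^ 2) := by
    intro x y hx
    have hxx : ⟪x, x⟫ = 1 := by rw [real_inner_self_eq_norm_sq, hx]; norm_num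
    obtain ⟨w, hw⟩ : ∃ w : V, w = y - ⟪x, y⟫ • x := ⟨_, rfl⟩
    have p : ⟪x, w⟫ = 0 := by rw [hw, inner_sub_right, inner_smul_right, hxx]; ring
    have q := b2 x w hx p
    rw [b4 x hx, ← real_inner_self_eq_norm_sq] at q
    have z1 : ∀ u v : V, R x x u v = 0 := fun u v => by have := hsym1 x x u v; linarith
    have z2 : R w x x x = 0 := by have := hsym2 w x x x; linarith
    have hy : y = ⟪x, y⟫ • x + w := by rw [hw]; abel
    generalize ⟪x, y⟫ = t at hy
    subst hy
    simp only [map_add, map_smul, LinearMap.add_apply, LinearMap.smul_apply, smul_eq_mul, z1, z2, q,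
      inner_add_left, inner_add_right, real_inner_smul_left, real_inner_smul_right, hxx, p,
      real_inner_comm x w]
    ring
  have b6 : ∀ x y : V, R y x x y = k * (⟪x, x⟫ * ⟪y, y⟫ - ⟪x, y⟫ ^ 2) := by
    intro x y
    by_cases hx : x = 0
    · subst hx; simp
    have hn : ‖x‖ ≠ 0 := norm_ne_zero_iff.mpr hx
    obtain ⟨v, hv, hxv⟩ : ∃ v : V, ‖v‖ = 1 ∧ v = ‖x‖⁻¹ • x :=
      ⟨_, by rw [norm_smul, norm_inv, norm_norm, inv_mul_cancel₀ hn], rfl⟩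
    have hxe : x = ‖x‖ • v := by rw [hxv, smul_smul, mul_inv_cancel₀ hn, one_smul]
    have hvv : ⟪v, v⟫ = 1 := by rw [real_inner_self_eq_norm_sq, hv]; norm_num
    have q := b5 v y hv
    clear hxv
    generalize ‖x‖ = t at hxe
    subst hxe
    simp only [map_smul, LinearMap.smul_apply, smul_eq_mul, q, real_inner_smul_left,
      real_inner_smul_right, hvv]
    ring
  -- polarization
  have c1 : ∀ x y u : V, R y x x u = k * (⟪x, x⟫ * ⟪y, u⟫ - ⟪x, y⟫ * ⟪x, u⟫) := by
    intro x y u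
    have e := b6 x (y + u)
    have e1 := b6 x y
    have e2 := b6 x u
    have e3 := hpair x y u
    have e4 := real_inner_comm y u
    simp only [map_add, LinearMap.add_apply, inner_add_left, inner_add_right] at e
    rw [e4] at e
    linarith
  have c2 : ∀ x y z u : V, R y x z u + R y z x u =
      k * (2 * ⟪x, z⟫ * ⟪y, u⟫ - ⟪x, y⟫ * ⟪z, u⟫ - ⟪z, y⟫ * ⟪x, u⟫) := by
    intro x y z u
    have e := c1 (x + z) y u
    have e1 := c1 x y u
    have e2 := c1 z y u
    have e4 := real_inner_comm x z
    simp only [map_add, LinearMap.add_apply, inner_add_left, inner_add_right] at e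
    rw [e4] at e
    linarith
  refine ⟨k, fun x y z u => ?_⟩
  have f1 := hbianchi x y z u
  have f2 := c2 y x z u
  have f3 := c2 x y z u
  have f4 := hsym1 y x z u
  have f5 := hsym1 x z y u
  rw [real_inner_comm x y, real_inner_comm x z] at f2
  rw [real_inner_comm y z] at f3
  linarith
end
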